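/- For every ℓ ≥ 1, every η = (η₁,…,η_ℓ) ∈ {0,1}^ℓ, and every k ∈ ℤ, the following equality of diagonal entries holds: Σ_{0 ≤ j₁ < … < j_ℓ ≤ n−1} ⟨δ_k, A_{η₁}^{(j₁)} A_{η₂}^{(j₂)} ⋯ A_{η_ℓ}^{(j_ℓ)} δ_k⟩ = Σ_{0 ≤ j₁ < … < j_ℓ ≤ n−1} ⟨δ_k, (A_{η_ℓ}^{(j₁)})^* (A_{η_{ℓ−1}}^{(j₂)})^* ⋯ (A_{η₁}^{(j_ℓ)})^* δ_k⟩. -/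

import Mathlib

noncomputable section

abbrev Hqw : Type := lp (fun _ : ℤ => ℂ) 2
abbrev Op : Type := Hqw →L[ℂ] Hqw

noncomputable def δ (j : ℤ) : Hqw := lp.single 2 j 1

def coord (ψ : Hqw) (i : ℤ) : ℂ := ψ i

/-- `B δ_j = δ_{j-1} - δ_{j+1}`. -/
def IsB (B : Op) : Prop := ∀ j : ℤ, B (δ j) = δ (j - 1) - δ (j + 1)

/-- `C δ_{2j} = δ_{2j+2}`, `C δ_{2j+1} = δ_{2j-1}`. -/
def IsC (C : Op) : Prop :=
  ∀ j : ℤ, C (δ (2 * j)) = δ (2 * j + 2) ∧ C (δ (2 * j + 1)) = δ (2 * j - 1)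

/-- the position sequence: `x_{2j} = x_{2j+1} = |j|`. -/
def IsPos (x : ℤ → ℝ) : Prop :=
  ∀ j : ℤ, x (2 * j) = |(j : ℝ)| ∧ x (2 * j + 1) = |(j : ℝ)|

/-- `K` is the commutator `[X, A]`, i.e. `⟨δ_i, K δ_j⟩ = (x_i - x_j) ⟨δ_i, A δ_j⟩`. -/
def IsXComm (x : ℤ → ℝ) (A K : Op) : Prop :=
  ∀ i j : ℤ, coord (K (δ j)) i = ((x i - x j : ℝ) : ℂ) * coord (A (δ j)) i

/-- a local field: a diagonal unitary `D δ_j = e^{iθ_j} δ_j`. -/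
def IsLocalField (D : Op) : Prop :=
  ∃ θ : ℤ → ℝ, ∀ j : ℤ, D (δ j) = Complex.exp ((θ j : ℂ) * Complex.I) • δ j

/-- `U_t = r² I + r t B + t² C` with `r = √(1 - t²)`. -/
def Ut (t : ℝ) (B C : Op) : Op :=
  (((Real.sqrt (1 - t ^ 2)) ^ 2 : ℝ) : ℂ) • (1 : Op) +
    ((Real.sqrt (1 - t ^ 2) * t : ℝ) : ℂ) • B + ((t ^ 2 : ℝ) : ℂ) • C

/-- `⟨X⟩_ψ = Σ_j x_j |⟨δ_j, ψ⟩|²`. -/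
def Xexp (x : ℤ → ℝ) (ψ : Hqw) : ℝ := ∑' j : ℤ, x j * ‖coord ψ j‖ ^ 2

/-- a unit vector supported on `span{δ₀, δ₁}`. -/
def IsInit (Ψ : Hqw) : Prop := ‖Ψ‖ = 1 ∧ ∃ a b : ℂ, Ψ = a • δ 0 + b • δ 1

/-- `α = e^{2πik/n}` with `k ∈ ℤ⁺`, `gcd(k,n) = 1`, `α ≠ 1`. -/
def IsAdmissible (n : ℕ) (α : ℂ) : Prop :=
  α ≠ 1 ∧ ∃ k : ℕ, 0 < k ∧ Nat.gcd k n = 1 ∧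
    α = Complex.exp (((2 * Real.pi * k / n : ℝ) : ℂ) * Complex.I)

/-- the `n`-periodic field `D_n δ_j = α^j δ_j`. -/
def IsDn (α : ℂ) (D : Op) : Prop := ∀ j : ℤ, D (δ j) = α ^ j • δ j

/-- `B^{(j)} = D_n^j B D_n^{-j}`, explicitly `B^{(j)} δ_i = α^{-j} δ_{i-1} - α^{j} δ_{i+1}`. -/
def IsBj (α : ℂ) (j : ℤ) (Bj : Op) : Prop :=
  ∀ i : ℤ, Bj (δ i) = α ^ (-j) • δ (i - 1) - α ^ j • δ (i + 1)

/-- `C^{(j)} = D_n^j C D_n^{-j}`, explicitly `C^{(j)} δ_{2i} = α^{2j} δ_{2i+2}`,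
`C^{(j)} δ_{2i+1} = α^{-2j} δ_{2i-1}`. -/
def IsCj (α : ℂ) (j : ℤ) (Cj : Op) : Prop :=
  ∀ i : ℤ, Cj (δ (2 * i)) = α ^ (2 * j) • δ (2 * i + 2) ∧
    Cj (δ (2 * i + 1)) = α ^ (-(2 * j)) • δ (2 * i - 1)

-- the elementary symmetric polynomial of operators `S^{ℓ,m}_{[a, n-1]}`:
-- sum over `a ≤ j₁ < … < j_ℓ ≤ n-1` and `η ∈ {0,1}^ℓ` with `|η| = m` of the ordered
-- products `A_{η₁}^{(j₁)} ⋯ A_{η_ℓ}^{(j_ℓ)}`, where `A_1 = C`, `A_0 = B`.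
open Classical in
noncomputable def Sop (Bf Cf : ℤ → Op) (a n ℓ m : ℕ) : Op :=
  ∑ p : (Fin ℓ → Fin n) × (Fin ℓ → Bool),
    if StrictMono p.1 ∧ (∀ k, a ≤ (p.1 k : ℕ)) ∧
        (Finset.univ.filter fun k => p.2 k = true).card = m then
      (List.ofFn fun k : Fin ℓ =>
        if p.2 k = true then Cf ((p.1 k : ℕ) : ℤ) else Bf ((p.1 k : ℕ) : ℤ)).prod
    else 0

def Aop (Bf Cf : ℤ → Op) (b : Bool) (j : ℤ) : Op := if b = true then Cf j else Bf j

lemma star_ofFn_prod : ∀ (l : ℕ) (f : Fin l → Op),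
    (List.ofFn fun i : Fin l => star (f (Fin.rev i))).prod = star (List.ofFn f).prod
  | 0, f => by simp
  | l + 1, f => by
    rw [List.ofFn_succ (f := f), List.ofFn_succ', List.prod_cons, List.concat_eq_append,
      List.prod_append, star_mul, ← star_ofFn_prod l (fun i => f i.succ)]
    simp [Fin.rev_castSucc]

lemma coord_adjoint (P : Op) (k : ℤ) :
    coord ((star P) (δ k)) k = (starRingEnd ℂ) (coord (P (δ k)) k) := by
  have h : ∀ v : Hqw, coord v k = inner ℂ (δ k) v := by
    intro v
    simp [δ, coord, lp.inner_single_left]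
  rw [h, h, ContinuousLinearMap.star_eq_adjoint, ContinuousLinearMap.adjoint_inner_right,
    inner_conj_symm]

/-- conjugation relation between matrix entries -/
def ConjRel (α : ℂ) (N : ℤ) (P P' : Op) : Prop :=
  ∀ s t : ℤ, (starRingEnd ℂ) (coord (P (δ t)) s) = α ^ (N * (t - s)) * coord (P' (δ t)) s

lemma coord_smul (a : ℂ) (x : Hqw) (s : ℤ) : coord (a • x) s = a * coord x s := by
  simp [coord]

lemma coord_sub (x y : Hqw) (s : ℤ) : coord (x - y) s = coord x s - coord y s := by
  simp [coord]

lemma rel_one (α : ℂ) (N : ℤ) : ConjRel α N 1 1 := by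
  intro s t
  by_cases h : s = t
  · subst h; simp [coord, δ]
  · simp [coord, δ, h]

lemma rel_mul (α : ℂ) (h0 : α ≠ 0) (hc : (starRingEnd ℂ) α = α⁻¹) (N : ℤ)
    (Bf Cf : ℤ → Op) (hBf : ∀ j : ℤ, IsBj α j (Bf j)) (hCf : ∀ j : ℤ, IsCj α j (Cf j))
    (P P' : Op) (h : ConjRel α N P P') (b : Bool) (j : ℤ) :
    ConjRel α N (P * Aop Bf Cf b (N - j)) (P' * Aop Bf Cf b j) := by
  intro s t
  have key : ∀ (a c : ℤ) (x : ℂ) (d : ℤ), a + N * (d - s) = N * (t - s) + c →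
      α ^ a * (α ^ (N * (d - s)) * x) = α ^ (N * (t - s)) * (α ^ c * x) := by
    intro a c x d hh
    rw [← mul_assoc, ← mul_assoc, ← zpow_add₀ h0, ← zpow_add₀ h0, hh]
  rw [ContinuousLinearMap.mul_apply, ContinuousLinearMap.mul_apply]
  cases b with
  | false =>
    simp only [Aop, Bool.false_eq_true, if_false]
    rw [hBf, hBf]
    simp only [map_sub, map_smul, coord_smul, coord_sub, map_mul, map_zpow₀, hc, h s _,
      inv_zpow', mul_sub]
    simp only [← mul_sub]
    rw [key _ (-j) _ _ (by ring), key _ j _ _ (by ring)]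
    ring
  | true =>
    simp only [Aop, if_true]
    obtain ⟨m, rfl | rfl⟩ := Int.even_or_odd' t
    · rw [(hCf _ m).1, (hCf _ m).1]
      simp only [map_smul, coord_smul, map_mul, map_zpow₀, hc, h s _, inv_zpow']
      exact key _ _ _ _ (by ring)
    · rw [(hCf _ m).2, (hCf _ m).2]
      simp only [map_smul, coord_smul, map_mul, map_zpow₀, hc, h s _, inv_zpow']
      exact key _ _ _ _ (by ring)

lemma rel_prod (α : ℂ) (h0 : α ≠ 0) (hc : (starRingEnd ℂ) α = α⁻¹) (N : ℤ)
    (Bf Cf : ℤ → Op) (hBf : ∀ j : ℤ, IsBj α j (Bf j)) (hCf : ∀ j : ℤ, IsCj α j (Cf j)) :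
    ∀ (l : ℕ) (η : Fin l → Bool) (p : Fin l → ℤ),
      ConjRel α N (List.ofFn fun i => Aop Bf Cf (η i) (N - p i)).prod
        (List.ofFn fun i => Aop Bf Cf (η i) (p i)).prod
  | 0, η, p => by simpa using rel_one α N
  | l + 1, η, p => by
    have ih := rel_prod α h0 hc N Bf Cf hBf hCf l (fun i => η i.castSucc) (fun i => p i.castSucc)
    rw [List.ofFn_succ', List.ofFn_succ', List.concat_eq_append, List.concat_eq_append,
      List.prod_append, List.prod_append, List.prod_singleton, List.prod_singleton]
    exact rel_mul α h0 hc N Bf Cf hBf hCf _ _ ih _ _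

def flipEquiv (l n : ℕ) : (Fin l → Fin n) ≃ (Fin l → Fin n) where
  toFun p i := Fin.rev (p (Fin.rev i))
  invFun p i := Fin.rev (p (Fin.rev i))
  left_inv p := by ext; simp
  right_inv p := by ext; simp

lemma flipEquiv_strictMono {l n : ℕ} (p : Fin l → Fin n) (h : StrictMono p) :
    StrictMono (flipEquiv l n p) := by
  intro a b hab
  simp only [flipEquiv, Equiv.coe_fn_mk]
  exact Fin.rev_lt_rev.2 (h (Fin.rev_lt_rev.2 hab))

open Classical in
/-- diagonal-entry symmetry claim: for every `ℓ ≥ 1`,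
`η ∈ {0,1}^ℓ` and `k ∈ ℤ`,
`Σ_{0 ≤ j₁ < … < j_ℓ ≤ n-1} ⟨δ_k, A_{η₁}^{(j₁)} ⋯ A_{η_ℓ}^{(j_ℓ)} δ_k⟩
 = Σ_{0 ≤ j₁ < … < j_ℓ ≤ n-1} ⟨δ_k, (A_{η_ℓ}^{(j₁)})^* (A_{η_{ℓ-1}}^{(j₂)})^* ⋯ (A_{η₁}^{(j_ℓ)})^* δ_k⟩`. -/
theorem stmt19 (n : ℕ) (hn : 0 < n) (α : ℂ) (hα : IsAdmissible n α)
    (Bf Cf : ℤ → Op) (hBf : ∀ j : ℤ, IsBj α j (Bf j)) (hCf : ∀ j : ℤ, IsCj α j (Cf j))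
    (l : ℕ) (hl : 1 ≤ l) (η : Fin l → Bool) (k : ℤ) :
    (∑ p : Fin l → Fin n,
      if StrictMono p then
        coord
          ((List.ofFn fun i : Fin l =>
              if η i = true then Cf ((p i : ℕ) : ℤ) else Bf ((p i : ℕ) : ℤ)).prod (δ k)) k
      else 0) =
    ∑ p : Fin l → Fin n,
      if StrictMono p then
        coord
          ((List.ofFn fun i : Fin l =>
              ContinuousLinearMap.adjoint
                (if η (Fin.rev i) = true then Cf ((p i : ℕ) : ℤ)
                 else Bf ((p i : ℕ) : ℤ))).prod (δ k)) k
      else 0 := by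
  obtain ⟨-, m, -, -, hm⟩ := hα
  have h0 : α ≠ 0 := hm ▸ Complex.exp_ne_zero _
  have hc : (starRingEnd ℂ) α = α⁻¹ := by
    rw [hm, ← Complex.exp_conj, ← Complex.exp_neg, map_mul, Complex.conj_ofReal,
      Complex.conj_I, mul_neg]
  refine Fintype.sum_equiv (flipEquiv l n) _ _ fun p => ?_
  have hiff : StrictMono (flipEquiv l n p) ↔ StrictMono p := by
    refine ⟨fun h => ?_, flipEquiv_strictMono p⟩
    have := flipEquiv_strictMono _ h
    rwa [show flipEquiv l n (flipEquiv l n p) = p from (flipEquiv l n).left_inv p] at this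
  simp only [hiff]
  split_ifs with hp
  · have e := star_ofFn_prod l
      (fun i => Aop Bf Cf (η i) (((n : ℤ) - 1) - ((p i : ℕ) : ℤ)))
    have hr := rel_prod α h0 hc ((n : ℤ) - 1) Bf Cf hBf hCf l η (fun i => ((p i : ℕ) : ℤ)) k k
    rw [← coord_adjoint, ← e] at hr
    simp only [sub_self, mul_zero, zpow_zero, one_mul] at hr
    have hj : ∀ i : Fin l, (((flipEquiv l n p i : Fin n) : ℕ) : ℤ)
        = (n : ℤ) - 1 - ((p (Fin.rev i) : ℕ) : ℤ) := by
      intro i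
      simp only [flipEquiv, Equiv.coe_fn_mk, Fin.val_rev]
      have := (p (Fin.rev i)).isLt
      omega
    simp only [hj]
    exact hr.symm
  · rfl
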